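/- Let f, a, b, c, d be real numbers with a² + b² ≤ 1, c² + d² ≤ 1, −1 ≤ f ≤ 1, and 1 + f + 2a + 2c ≥ 0. If the six inequalities 1/6 + f/6 + 2a/3 ≥ 0, 1/6 + f/6 + 2c/3 ≥ 0, 1/6 + f/6 − a/3 + (√3/3)·b ≥ 0, 1/6 + f/6 − a/3 − (√3/3)·b ≥ 0, 1/6 + f/6 − c/3 + (√3/3)·d ≥ 0, and 1/6 + f/6 − c/3 − (√3/3)·d ≥ 0 all hold, then there exists a 6×6 doubly stochastic matrix whose eigenvalues, counted with algebraic multiplicity, are 1, f, a + ib, a − ib, c + id, c − id (where i is the imaginary unit). -/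

import Mathlib

open Matrix Polynomial

/-- A real square matrix is doubly stochastic if its entries are nonnegative and all of its
row sums and column sums are equal to `1`. -/
def DoublyStochastic {n : ℕ} (D : Matrix (Fin n) (Fin n) ℝ) : Prop :=
  (∀ i j, 0 ≤ D i j) ∧ (∀ i, ∑ j, D i j = 1) ∧ (∀ j, ∑ i, D i j = 1)

noncomputable def dsBlk (f a b c d s : ℝ) : Matrix (Fin 6) (Fin 6) ℝ :=
  let p0 := 1 / 6 + f / 6 + 2 * a / 3
  let p1 := 1 / 6 + f / 6 - a / 3 - s / 3 * b
  let p2 := 1 / 6 + f / 6 - a / 3 + s / 3 * b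
  let q0 := 1 / 6 + f / 6 + 2 * c / 3
  let q1 := 1 / 6 + f / 6 - c / 3 - s / 3 * d
  let q2 := 1 / 6 + f / 6 - c / 3 + s / 3 * d
  let t := (1 - f) / 6
  !![p0, p1, p2, t, t, t;
     p2, p0, p1, t, t, t;
     p1, p2, p0, t, t, t;
     t, t, t, q0, q1, q2;
     t, t, t, q2, q0, q1;
     t, t, t, q1, q2, q0]

noncomputable def dsV : Matrix (Fin 6) (Fin 6) ℝ :=
  !![1, 1, 2, 0, 0, 0;
     1, 1, -1, 1, 0, 0;
     1, 1, -1, -1, 0, 0;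
     1, -1, 0, 0, 2, 0;
     1, -1, 0, 0, -1, 1;
     1, -1, 0, 0, -1, -1]

noncomputable def dsW : Matrix (Fin 6) (Fin 6) ℝ :=
  !![1/6, 1/6, 1/6, 1/6, 1/6, 1/6;
     1/6, 1/6, 1/6, -1/6, -1/6, -1/6;
     1/3, -1/6, -1/6, 0, 0, 0;
     0, 1/2, -1/2, 0, 0, 0;
     0, 0, 0, 1/3, -1/6, -1/6;
     0, 0, 0, 0, 1/2, -1/2]

noncomputable def dsM (f a b c d s : ℝ) : Matrix (Fin 6) (Fin 6) ℝ :=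
  !![1, 0, 0, 0, 0, 0;
     0, f, 0, 0, 0, 0;
     0, 0, a, -(s * b / 3), 0, 0;
     0, 0, s * b, a, 0, 0;
     0, 0, 0, 0, c, -(s * d / 3);
     0, 0, 0, 0, s * d, c]

lemma dsVW : dsV * dsW = 1 := by
  ext i j
  fin_cases i <;> fin_cases j <;>
    simp [dsV, dsW, Matrix.mul_apply, Fin.sum_univ_succ] <;> norm_num

lemma dsBlk_eq (f a b c d s : ℝ) :
    dsBlk f a b c d s = dsV * dsM f a b c d s * dsW := by
  ext i j
  fin_cases i <;> fin_cases j <;>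
    simp [dsBlk, dsM, dsV, dsW, Matrix.mul_apply, Fin.sum_univ_succ] <;> ring

lemma dsM_charpoly (f a b c d s : ℝ) (hs : s * s = 3) :
    (dsM f a b c d s).charpoly =
      (X - C 1) * (X - C f) * ((X - C a) ^ 2 + C b ^ 2) * ((X - C c) ^ 2 + C d ^ 2) := by
  have key : ∀ y : ℝ, C (s * y) * C (s * y / 3) = C y ^ 2 := by
    intro y
    rw [← C_mul, ← C_pow]
    congr 1
    linear_combination (y ^ 2 / 3) * hs
  have hb := key b
  have hd := key d
  unfold Matrix.charpoly
  have : (dsM f a b c d s).charmatrix =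
      !![X - C 1, 0, 0, 0, 0, 0;
         0, X - C f, 0, 0, 0, 0;
         0, 0, X - C a, C (s * b / 3), 0, 0;
         0, 0, - C (s * b), X - C a, 0, 0;
         0, 0, 0, 0, X - C c, C (s * d / 3);
         0, 0, 0, 0, - C (s * d), X - C c] := by
    ext1 i j
    fin_cases i <;> fin_cases j <;> simp [dsM]
  rw [this, ← hb, ← hd]
  generalize C (s * b) = x1
  generalize C (s * b / 3) = x2
  generalize C (s * d) = x3
  generalize C (s * d / 3) = x4
  simp [Matrix.det_succ_row_zero, Fin.sum_univ_succ, Fin.succAbove]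
  ring

lemma ds_conj (V W M D : Matrix (Fin 6) (Fin 6) ℝ) (h : V * W = 1) (hD : D = V * M * W) :
    D.charpoly = M.charpoly := by
  subst hD
  rw [Matrix.charpoly_mul_comm, ← Matrix.mul_assoc, _root_.mul_eq_one_comm.mp h, Matrix.one_mul]

lemma dsBlk_charpoly (f a b c d s : ℝ) (hs : s * s = 3) :
    (dsBlk f a b c d s).charpoly =
      (X - C 1) * (X - C f) * ((X - C a) ^ 2 + C b ^ 2) * ((X - C c) ^ 2 + C d ^ 2) := by
  exact (ds_conj dsV dsW _ _ dsVW (dsBlk_eq f a b c d s)).trans (dsM_charpoly f a b c d s hs)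

/-- If `f, a, b, c, d` are real with `a² + b² ≤ 1`, `c² + d² ≤ 1`, `-1 ≤ f ≤ 1`,
`1 + f + 2a + 2c ≥ 0`, and the six stated inequalities hold, then
`1, f, a + ib, a - ib, c + id, c - id` is the spectrum of a `6 × 6` doubly stochastic
matrix. -/
theorem diep_six_complex (f a b c d : ℝ)
    (hab : a ^ 2 + b ^ 2 ≤ 1) (hcd : c ^ 2 + d ^ 2 ≤ 1)
    (hf1 : -1 ≤ f) (hf2 : f ≤ 1)
    (htr : 0 ≤ 1 + f + 2 * a + 2 * c)
    (h1 : 0 ≤ 1 / 6 + f / 6 + 2 * a / 3)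
    (h2 : 0 ≤ 1 / 6 + f / 6 + 2 * c / 3)
    (h3 : 0 ≤ 1 / 6 + f / 6 - a / 3 + Real.sqrt 3 / 3 * b)
    (h4 : 0 ≤ 1 / 6 + f / 6 - a / 3 - Real.sqrt 3 / 3 * b)
    (h5 : 0 ≤ 1 / 6 + f / 6 - c / 3 + Real.sqrt 3 / 3 * d)
    (h6 : 0 ≤ 1 / 6 + f / 6 - c / 3 - Real.sqrt 3 / 3 * d) :
    ∃ D : Matrix (Fin 6) (Fin 6) ℝ, DoublyStochastic D ∧
      D.charpoly.map (algebraMap ℝ ℂ) =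
        (X - C 1) * (X - C (f : ℂ)) *
          (X - C ((a : ℂ) + (b : ℂ) * Complex.I)) *
          (X - C ((a : ℂ) - (b : ℂ) * Complex.I)) *
          (X - C ((c : ℂ) + (d : ℂ) * Complex.I)) *
          (X - C ((c : ℂ) - (d : ℂ) * Complex.I)) := by
  have hs : Real.sqrt 3 * Real.sqrt 3 = 3 := Real.mul_self_sqrt (by norm_num)
  refine ⟨dsBlk f a b c d (Real.sqrt 3), ⟨?_, ?_, ?_⟩, ?_⟩
  · have ht : 0 ≤ (1 - f) / 6 := by linarith
    intro i j
    fin_cases i <;> fin_cases j <;> first | exact ht | exact h1 | exact h2 | exact h3 | exact h4 | exact h5 | exact h6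
  · intro i
    fin_cases i <;> simp [dsBlk, Fin.sum_univ_succ] <;> ring
  · intro i
    fin_cases i <;> simp [dsBlk, Fin.sum_univ_succ] <;> ring
  · have hI : (C Complex.I : ℂ[X]) ^ 2 = -1 := by
      rw [← C_pow, Complex.I_sq]; simp
    rw [dsBlk_charpoly _ _ _ _ _ _ hs]
    simp only [Polynomial.map_mul, Polynomial.map_sub, Polynomial.map_add, Polynomial.map_pow,
      Polynomial.map_X, Polynomial.map_C, Complex.coe_algebraMap, Complex.ofReal_one,
      C_add, C_sub, C_mul]
    have e : ∀ A B : ℂ[X], (X - A) ^ 2 + B ^ 2 =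
        (X - (A + B * C Complex.I)) * (X - (A - B * C Complex.I)) := by
      intro A B
      linear_combination (B ^ 2) * hI
    rw [e, e]
    ring
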